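/- Let g : ℝ → ℝ be a continuous nondecreasing function, and let u, v ∈ L¹(ℝ^d, (1∧j(|x|))dx) be such that g(u), g(v) ∈ L¹_loc(Ω) and each of u and v is a distributional solution of −Lw = −g(w) in Ω, i.e. −∫_{ℝ^d} w(x) Lξ(x) dx = −∫_Ω g(w(x)) ξ(x) dx for all ξ ∈ C_c^∞(Ω). Then max(u,v) is a distributional subsolution and min(u,v) is a distributional supersolution: for every ξ ∈ C_c^∞(Ω) with ξ ≥ 0, −∫_{ℝ^d} max(u,v)(x) Lξ(x) dx ≤ −∫_Ω g(max(u,v)(x)) ξ(x) dx and −∫_{ℝ^d} min(u,v)(x) Lξ(x) dx ≥ −∫_Ω g(min(u,v)(x)) ξ(x) dx. -/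

import Mathlib

open MeasureTheory Filter Topology Set

noncomputable section

/-- The truncated integral `∫_{|y|>r} (w(x+y) - w(x)) j(|y|) dy` approximating the
principal value defining `Lw(x)`. -/
noncomputable def truncL (d : ℕ) (j : ℝ → ℝ) (w : EuclideanSpace ℝ (Fin d) → ℝ)
    (x : EuclideanSpace ℝ (Fin d)) (r : ℝ) : ℝ :=
  ∫ y in {y : EuclideanSpace ℝ (Fin d) | r < ‖y‖}, (w (x + y) - w x) * j ‖y‖

/-- The principal value `Lw(x) = lim_{δ↓0} ∫_{|y|>δ} (w(x+y) - w(x)) j(|y|) dy`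
exists and equals `ℓ`. -/
def HasPVLim (d : ℕ) (j : ℝ → ℝ) (w : EuclideanSpace ℝ (Fin d) → ℝ)
    (x : EuclideanSpace ℝ (Fin d)) (ℓ : ℝ) : Prop :=
  Tendsto (truncL d j w x) (𝓝[>] (0:ℝ)) (𝓝 ℓ)

/-- `ξ ∈ C_c^∞(Ω)`. -/
def IsTestOn (d : ℕ) (Ω : Set (EuclideanSpace ℝ (Fin d)))
    (ξ : EuclideanSpace ℝ (Fin d) → ℝ) : Prop :=
  ContDiff ℝ (⊤ : ℕ∞) ξ ∧ HasCompactSupport ξ ∧ tsupport ξ ⊆ Ω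


/-! ### Helper lemmas -/

abbrev EE (d : ℕ) := EuclideanSpace ℝ (Fin d)

/-- The standing hypotheses on the kernel. -/
structure JK (d : ℕ) (j : ℝ → ℝ) (κ : ℝ) : Prop where
  pos : ∀ r > 0, 0 < j r
  anti : AntitoneOn j (Set.Ioi 0)
  int : Integrable (fun y : EE d => min 1 (‖y‖ ^ 2) * j ‖y‖)
  k1 : 1 ≤ κ
  doub : ∀ r > 0, j r ≤ κ * j (2 * r)

/-- The truncated kernel. -/
def kerT (d : ℕ) (j : ℝ → ℝ) (δ : ℝ) (y : EE d) : ℝ := if δ < ‖y‖ then j ‖y‖ else 0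

/-- A regularised weight. -/
def WW (d : ℕ) (j : ℝ → ℝ) (x : EE d) : ℝ := j (max ‖x‖ 1)

section
variable {d : ℕ} {j : ℝ → ℝ} {κ : ℝ}

lemma JK.le (h : JK d j κ) {a b : ℝ} (ha : 0 < a) (hab : a ≤ b) : j b ≤ j a :=
  h.anti ha (lt_of_lt_of_le ha hab) hab

lemma JK.anti_max (h : JK d j κ) {a : ℝ} (ha : 0 < a) : Antitone (fun r => j (max r a)) := by
  intro r s hrs
  exact h.le (lt_max_of_lt_right ha) (max_le_max_right a hrs)

lemma JK.W_pos (h : JK d j κ) (x : EE d) : 0 < WW d j x :=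
  h.pos _ (lt_max_of_lt_right one_pos)

lemma JK.W_le (h : JK d j κ) (x : EE d) : WW d j x ≤ j 1 :=
  h.le one_pos (le_max_right _ _)

lemma JK.W_meas (h : JK d j κ) : Measurable (WW d j) :=
  (h.anti_max one_pos).measurable.comp measurable_norm

lemma WW_neg (x : EE d) : WW d j (-x) = WW d j x := by simp [WW]

lemma JK.doub_pow (h : JK d j κ) (n : ℕ) : ∀ r > 0, j r ≤ κ ^ n * j (2 ^ n * r) := by
  induction n with
  | zero => intro r _; simp
  | succ n ih =>
    intro r hr
    have h0 : 0 ≤ κ := by linarith [h.k1]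
    calc j r ≤ κ ^ n * j (2 ^ n * r) := ih r hr
      _ ≤ κ ^ n * (κ * j (2 * (2 ^ n * r))) := by
        gcongr
        exact h.doub _ (by positivity)
      _ = κ ^ (n+1) * j (2 ^ (n+1) * r) := by
        rw [pow_succ, pow_succ, mul_assoc]; congr 3; ring

lemma JK.W_shift (h : JK d j κ) (R : ℝ) :
    ∃ C > 0, ∀ x z : EE d, ‖x - z‖ ≤ R → WW d j x ≤ C * WW d j z := by
  obtain ⟨n, hn⟩ := pow_unbounded_of_one_lt (R + 1) (one_lt_two)
  have hk : 0 < κ := by linarith [h.k1]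
  refine ⟨κ ^ n, by positivity, fun x z hxz => ?_⟩
  have h1 : (0:ℝ) < max ‖x‖ 1 := lt_max_of_lt_right one_pos
  refine (h.doub_pow n _ h1).trans ?_
  unfold WW
  gcongr
  apply h.le (lt_max_of_lt_right one_pos)
  have h2 : 1 ≤ max ‖x‖ 1 := le_max_right _ _
  have h3 : ‖x‖ ≤ max ‖x‖ 1 := le_max_left _ _
  have hR : 0 ≤ R := (norm_nonneg _).trans hxz
  have h4 : ‖z‖ ≤ ‖x‖ + R := by
    have := norm_sub_norm_le z x
    rw [norm_sub_rev] at this; linarith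
  have h5 : (R + 1) * max ‖x‖ 1 ≤ 2 ^ n * max ‖x‖ 1 := by gcongr
  apply max_le <;> nlinarith

lemma JK.ker_nonneg (h : JK d j κ) {δ : ℝ} (hδ : 0 < δ) (y : EE d) : 0 ≤ kerT d j δ y := by
  unfold kerT
  split_ifs with hy
  · exact (h.pos _ (hδ.trans hy)).le
  · exact le_rfl

lemma JK.ker_meas (h : JK d j κ) {δ : ℝ} (hδ : 0 < δ) : Measurable (kerT d j δ) := by
  have : kerT d j δ = fun y : EE d => if δ < ‖y‖ then j (max ‖y‖ δ) else 0 := by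
    funext y
    unfold kerT
    split_ifs with hy
    · rw [max_eq_left hy.le]
    · rfl
  rw [this]
  exact Measurable.ite (measurableSet_lt measurable_const measurable_norm)
    ((h.anti_max hδ).measurable.comp measurable_norm) measurable_const

lemma JK.ker_le (h : JK d j κ) {δ : ℝ} (hδ : 0 < δ) :
    ∃ C > 0, ∀ y : EE d, kerT d j δ y ≤ C * WW d j y := by
  have h1 := h.pos 1 one_pos
  have h2 := h.pos δ hδ
  refine ⟨1 + j δ / j 1, by positivity, fun y => ?_⟩
  have hW := h.W_pos y
  unfold kerT
  split_ifs with hy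
  · rcases le_total 1 ‖y‖ with h3 | h3
    · have : WW d j y = j ‖y‖ := by simp [WW, h3]
      rw [this] at hW ⊢
      have : 0 ≤ j δ / j 1 * j ‖y‖ := by positivity
      linarith
    · have : WW d j y = j 1 := by simp [WW, h3]
      rw [this, add_mul, div_mul_cancel₀ _ h1.ne']
      have := h.le hδ hy.le
      linarith
  · positivity

lemma JK.ker_int (h : JK d j κ) {δ : ℝ} (hδ : 0 < δ) : Integrable (kerT d j δ) := by
  have hm : 0 < min 1 (δ ^ 2) := by positivity
  refine Integrable.mono' (h.int.norm.const_mul (min 1 (δ ^ 2))⁻¹)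
    (h.ker_meas hδ).aestronglyMeasurable (Eventually.of_forall fun y => ?_)
  rw [Real.norm_of_nonneg (h.ker_nonneg hδ y)]
  unfold kerT
  split_ifs with hy
  · have hj := h.pos _ (hδ.trans hy)
    rw [norm_mul, Real.norm_of_nonneg hj.le, Real.norm_of_nonneg (by positivity), ← mul_assoc]
    have : 1 ≤ (min 1 (δ ^ 2))⁻¹ * min 1 (‖y‖ ^ 2) := by
      rw [inv_mul_eq_div, one_le_div hm]
      gcongr
    nlinarith
  · positivity

lemma kerT_neg (δ : ℝ) (y : EE d) : kerT d j δ (-y) = kerT d j δ y := by simp [kerT]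

lemma truncL_eq (w : EE d → ℝ) (x : EE d) (δ : ℝ) :
    truncL d j w x δ = ∫ y, (w (x + y) - w x) * kerT d j δ y := by
  unfold truncL
  rw [← integral_indicator (measurableSet_lt measurable_const measurable_norm)]
  congr 1
  funext y
  by_cases hy : δ < ‖y‖ <;> simp [kerT, hy, Set.indicator]

lemma JK.truncL_meas (h : JK d j κ) {δ : ℝ} (hδ : 0 < δ) {η : EE d → ℝ} (hη : Measurable η) :
    Measurable (fun x => truncL d j η x δ) := by
  simp_rw [truncL_eq]
  have hk := h.ker_meas hδ
  have : StronglyMeasurable (Function.uncurry fun (x y : EE d) => (η (x + y) - η x) * kerT d j δ y) := by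
    apply Measurable.stronglyMeasurable
    unfold Function.uncurry
    fun_prop
  exact this.integral_prod_right.measurable

lemma JK.bdd_ker_int (h : JK d j κ) {δ : ℝ} (hδ : 0 < δ) {η : EE d → ℝ} (hη : Measurable η)
    {M : ℝ} (hM : ∀ x, |η x| ≤ M) : Integrable (fun y => η y * kerT d j δ y) :=
  (h.ker_int hδ).bdd_mul (c := M) hη.aestronglyMeasurable (Eventually.of_forall hM)

lemma JK.conv_bdd (h : JK d j κ) {δ : ℝ} (hδ : 0 < δ) {η : EE d → ℝ} (hη : Measurable η)
    {M R : ℝ} (hM : ∀ x, |η x| ≤ M) (hR : ∀ x, R < ‖x‖ → η x = 0) :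
    ∃ C, ∀ x, |truncL d j η x δ| ≤ C * WW d j x := by
  have hM0 : 0 ≤ M := (abs_nonneg _).trans (hM 0)
  obtain ⟨C1, hC1, H1⟩ := h.ker_le (δ := δ) hδ
  obtain ⟨C2, hC2, H2⟩ := h.W_shift R
  set I := ∫ y : EE d, kerT d j δ y with hI
  have hI0 : 0 ≤ I := integral_nonneg (h.ker_nonneg hδ)
  set V := (volume (Metric.closedBall (0 : EE d) R)).toReal
  refine ⟨M * (C1 * C2) * V + M * I * (C2 * (WW d j 0)⁻¹), fun x => ?_⟩
  have hm1 : Measurable fun y => η (x + y) := by fun_prop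
  have hi1 := h.bdd_ker_int hδ hm1 (M := M) (fun y => hM _)
  have hi2 : Integrable (fun y => η x * kerT d j δ y) := (h.ker_int hδ).const_mul _
  have e : truncL d j η x δ = (∫ y, η (x + y) * kerT d j δ y) - η x * I := by
    rw [truncL_eq, hI, ← integral_const_mul, ← integral_sub hi1 hi2]
    congr 1; funext y; ring
  have hW := h.W_pos x
  have hW0 := h.W_pos (0 : EE d)
  have b2 : |η x * I| ≤ M * I * (C2 * (WW d j 0)⁻¹) * WW d j x := by
    by_cases hx : R < ‖x‖
    · rw [hR x hx]; simp; positivity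
    · have := H2 0 x (by simpa using hx)
      have h3 : 1 ≤ (C2 * (WW d j 0)⁻¹) * WW d j x := by
        rw [mul_assoc, inv_mul_eq_div, ← mul_div_assoc, one_le_div hW0]; exact this
      rw [abs_mul, abs_of_nonneg hI0]
      have := hM x
      calc |η x| * I ≤ M * I * 1 := by rw [mul_one]; gcongr
        _ ≤ M * I * ((C2 * (WW d j 0)⁻¹) * WW d j x) := by gcongr
        _ = _ := by ring
  have b1 : |∫ y, η (x + y) * kerT d j δ y| ≤ M * (C1 * C2) * V * WW d j x := by
    have : ∀ y, ‖η (x + y) * kerT d j δ y‖ ≤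
        (Metric.closedBall (-x) R).indicator (fun _ => M * (C1 * C2) * WW d j x) y := by
      intro y
      by_cases hy : y ∈ Metric.closedBall (-x) R
      · rw [Set.indicator_of_mem hy, norm_mul, Real.norm_of_nonneg (h.ker_nonneg hδ y),
          Real.norm_eq_abs]
        have h4 := H2 y (-x) (by simpa [dist_eq_norm] using hy)
        rw [WW_neg] at h4
        calc |η (x+y)| * kerT d j δ y ≤ M * (C1 * (C2 * WW d j x)) := by
              apply mul_le_mul (hM _) _ (h.ker_nonneg hδ y) hM0
              exact (H1 y).trans (by gcongr)
          _ = _ := by ring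
      · rw [Set.indicator_of_notMem hy, hR, zero_mul, norm_zero]
        simpa [dist_eq_norm, add_comm] using hy
    have h5 := norm_integral_le_of_norm_le (μ := volume)
      ((integrable_indicator_iff Metric.isClosed_closedBall.measurableSet).2
        (integrableOn_const (by exact (isCompact_closedBall (-x) R).measure_lt_top.ne))) (Eventually.of_forall this)
    rw [integral_indicator Metric.isClosed_closedBall.measurableSet, setIntegral_const] at h5
    rw [Real.norm_eq_abs] at h5
    refine h5.trans (le_of_eq ?_)
    rw [Measure.real, Measure.addHaar_closedBall_center, smul_eq_mul]
    ring
  rw [e]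
  calc _ ≤ |∫ y, η (x + y) * kerT d j δ y| + |η x * I| := abs_sub _ _
    _ ≤ _ := by rw [add_mul]; linarith
end

section
variable {d : ℕ} {j : ℝ → ℝ} {κ : ℝ}

lemma second_diff {ψ : EE d → ℝ} (h1 : ContDiff ℝ (⊤ : ℕ∞) ψ) (h2 : HasCompactSupport ψ) :
    ∃ K ≥ 0, ∀ z y : EE d, |ψ (z + y) + ψ (z - y) - 2 * ψ z| ≤ K * ‖y‖ ^ 2 := by
  have hd1 : ContDiff ℝ 1 (fderiv ℝ ψ) := h1.fderiv_right (by norm_cast)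
  obtain ⟨K, hK⟩ := ContDiff.lipschitzWith_of_hasCompactSupport (h2.fderiv ℝ) hd1 one_ne_zero
  have hdiff : Differentiable ℝ ψ := h1.differentiable (by simp)
  refine ⟨2 * K, by positivity, fun z y => ?_⟩
  have hD : ∀ t : EE d, HasFDerivAt (fun t => ψ (z + t) + ψ (z - t) - 2 * ψ z)
      (fderiv ℝ ψ (z + t) - fderiv ℝ ψ (z - t)) t := by
    intro t
    have a1 : HasFDerivAt (fun t : EE d => z + t) (ContinuousLinearMap.id ℝ (EE d)) t :=
      (hasFDerivAt_id t).const_add z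
    have a2 : HasFDerivAt (fun t : EE d => z - t) (-ContinuousLinearMap.id ℝ (EE d)) t :=
      (hasFDerivAt_id t).const_sub z
    have b1 := (hdiff (z + t)).hasFDerivAt.comp t a1
    have b2 := (hdiff (z - t)).hasFDerivAt.comp t a2
    have := (b1.add b2).sub_const (2 * ψ z)
    refine this.congr_fderiv ?_
    ext s; simp [sub_eq_add_neg]
  have := (convex_closedBall (0 : EE d) ‖y‖).norm_image_sub_le_of_norm_hasFDerivWithin_le
    (C := 2 * K * ‖y‖) (fun t _ => (hD t).hasFDerivWithinAt) (fun t ht => by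
      have ht' : ‖t‖ ≤ ‖y‖ := by simpa using ht
      have h3 := hK.dist_le_mul (z + t) (z - t)
      rw [dist_eq_norm, dist_eq_norm] at h3
      refine h3.trans ?_
      have : z + t - (z - t) = (2:ℝ) • t := by rw [two_smul]; abel
      rw [this, norm_smul, Real.norm_two]
      have : (0:ℝ) ≤ K := K.2
      nlinarith [mul_le_mul_of_nonneg_left ht' this]) (x := 0) (y := y) (by simp) (by simp)
  simp only [add_zero, sub_zero, Real.norm_eq_abs] at this
  have e : ψ (z + y) + ψ (z - y) - 2 * ψ z - (ψ z + ψ z - 2 * ψ z) =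
    ψ (z + y) + ψ (z - y) - 2 * ψ z := by ring
  rw [e] at this
  rw [pow_two, ← mul_assoc]; exact this

lemma JK.truncL_symm (h : JK d j κ) {δ : ℝ} (hδ : 0 < δ) {η : EE d → ℝ} (hη : Measurable η)
    {M : ℝ} (hM : ∀ x, |η x| ≤ M) (z : EE d) :
    truncL d j η z δ =
      ∫ y, (1/2) * ((η (z + y) + η (z - y) - 2 * η z) * kerT d j δ y) := by
  have hb : ∀ x, |η x - η z| ≤ 2 * M := fun x => by
    have := abs_sub (η x) (η z)
    linarith [hM x, hM z]
  have i1 := h.bdd_ker_int hδ (η := fun y => η (z + y) - η z) (by fun_prop) (fun y => hb _)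
  have i2 := h.bdd_ker_int hδ (η := fun y => η (z - y) - η z) (by fun_prop) (fun y => hb _)
  have e2 : truncL d j η z δ = ∫ y, (η (z - y) - η z) * kerT d j δ y := by
    rw [truncL_eq, ← integral_neg_eq_self]
    simp only [kerT_neg, sub_eq_add_neg]
  have e1 := truncL_eq (j := j) η z δ
  rw [integral_const_mul]
  have : ∫ y, (η (z + y) + η (z - y) - 2 * η z) * kerT d j δ y =
      truncL d j η z δ + truncL d j η z δ := by
    nth_rewrite 1 [e1]
    rw [e2, ← integral_add i1 i2]
    congr 1; funext y; ring
  rw [this]; ring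

/-- Uniform bound and existence of the principal value for test functions. -/
lemma JK.test (h : JK d j κ) {ψ : EE d → ℝ} (h1 : ContDiff ℝ (⊤ : ℕ∞) ψ)
    (h2 : HasCompactSupport ψ) :
    (∃ C, ∀ δ > 0, ∀ z, |truncL d j ψ z δ| ≤ C * WW d j z) ∧
      ∀ z, ∃ l, HasPVLim d j ψ z l := by
  have hm : Measurable ψ := h1.continuous.measurable
  obtain ⟨M, hM⟩ := h2.exists_bound_of_continuous h1.continuous
  obtain ⟨K, hK0, hK⟩ := second_diff h1 h2
  obtain ⟨R, hR⟩ := h2.isCompact.isBounded.subset_closedBall (0 : EE d)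
  have hR' : ∀ x, R < ‖x‖ → ψ x = 0 := by
    intro x hx
    by_contra hne
    have := hR (subset_tsupport _ hne)
    simp at this; linarith
  have hM0 : 0 ≤ M := (norm_nonneg _).trans (hM 0)
  have hM' : ∀ x, |ψ x| ≤ M := hM
  set B := K + 4 * M with hB
  have hB0 : 0 ≤ B := by positivity
  have hdiff : ∀ z y, |ψ (z + y) + ψ (z - y) - 2 * ψ z| ≤ B * min 1 (‖y‖ ^ 2) := by
    intro z y
    rcases le_total 1 (‖y‖^2) with hy | hy
    · rw [min_eq_left hy]
      have := abs_le.1 (hM' (z+y)); have := abs_le.1 (hM' (z-y)); have := abs_le.1 (hM' z)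
      rw [abs_le]; constructor <;> linarith
    · rw [min_eq_right hy]
      refine (hK z y).trans ?_
      gcongr; linarith
  have hdom : ∀ δ > 0, ∀ z y, ‖(1/2) * ((ψ (z + y) + ψ (z - y) - 2 * ψ z) * kerT d j δ y)‖ ≤
      B * ‖min 1 (‖y‖ ^ 2) * j ‖y‖‖ := by
    intro δ hδ z y
    rw [norm_mul, norm_mul, norm_mul, Real.norm_eq_abs (_ - _)]
    have e1 : ‖kerT d j δ y‖ ≤ ‖j ‖y‖‖ := by
      unfold kerT; split_ifs <;> simp
    have e2 : ‖(1/2 : ℝ)‖ ≤ 1 := by norm_num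
    have e3 := hdiff z y
    calc _ ≤ 1 * ((B * min 1 (‖y‖^2)) * ‖j ‖y‖‖) := by gcongr
      _ = _ := by rw [Real.norm_of_nonneg (r := min 1 (‖y‖^2)) (by positivity)]; ring
  constructor
  · set I := ∫ y : EE d, B * ‖min 1 (‖y‖ ^ 2) * j ‖y‖‖ with hI
    have hI0 : 0 ≤ I := integral_nonneg fun y => by positivity
    have hglob : ∀ δ > 0, ∀ z, |truncL d j ψ z δ| ≤ I := by
      intro δ hδ z
      rw [h.truncL_symm hδ hm hM']
      exact norm_integral_le_of_norm_le (h.int.norm.const_mul _) (Eventually.of_forall (hdom δ hδ z))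
    obtain ⟨C1, hC1, H1⟩ := h.ker_le (δ := 1) one_pos
    obtain ⟨C3, H3⟩ := h.conv_bdd one_pos (η := fun x => |ψ x|) (by fun_prop) (M := M) (R := R)
      (fun x => by simpa using hM' x) (fun x hx => by simp [hR' x hx])
    obtain ⟨C2, hC2, H2⟩ := h.W_shift (R + 1)
    refine ⟨|C3| + I * (C2 * (WW d j 0)⁻¹), fun δ hδ z => ?_⟩
    have hW := h.W_pos z
    have hW0 := h.W_pos (0 : EE d)
    by_cases hz : ‖z‖ ≤ R + 1
    · have := H2 0 z (by simpa using hz)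
      have h3 : 1 ≤ (C2 * (WW d j 0)⁻¹) * WW d j z := by
        rw [mul_assoc, inv_mul_eq_div, ← mul_div_assoc, one_le_div hW0]; exact this
      calc _ ≤ I * 1 := by rw [mul_one]; exact hglob δ hδ z
        _ ≤ I * ((C2 * (WW d j 0)⁻¹) * WW d j z) := by gcongr
        _ ≤ _ := by
          have : 0 ≤ |C3| * WW d j z := by positivity
          nlinarith
    · push Not at hz
      have hz0 : ψ z = 0 := hR' z (by linarith)
      have key : |truncL d j ψ z δ| ≤ truncL d j (fun x => |ψ x|) z 1 := by
        rw [truncL_eq, truncL_eq]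
        have hi := h.bdd_ker_int one_pos (η := fun y => |ψ (z + y)| - |ψ z|) (by fun_prop) (M := M)
          (fun y => by simp [hz0, hM'])
        rw [← Real.norm_eq_abs]
        refine norm_integral_le_of_norm_le hi (Eventually.of_forall fun y => ?_)
        rw [hz0, norm_mul, Real.norm_of_nonneg (h.ker_nonneg hδ y)]
        simp only [sub_zero, abs_zero, Real.norm_eq_abs]
        by_cases hzy : R < ‖z + y‖
        · simp [hR' _ hzy]
        · have : 1 < ‖y‖ := by
            have := norm_sub_norm_le z (-y)
            simp at this; linarith
          have e : kerT d j 1 y = j ‖y‖ := by simp [kerT, this]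
          rw [e]
          gcongr
          unfold kerT; split_ifs
          · exact le_rfl
          · exact (h.pos _ (by linarith)).le
      calc _ ≤ _ := key.trans (le_abs_self _)
        _ ≤ C3 * WW d j z := H3 z
        _ ≤ |C3| * WW d j z := by gcongr; exact le_abs_self _
        _ ≤ _ := by
          have : 0 ≤ I * (C2 * (WW d j 0)⁻¹) * WW d j z := by positivity
          nlinarith
  · intro z
    refine ⟨∫ y, (1/2) * ((ψ (z + y) + ψ (z - y) - 2 * ψ z) * j ‖y‖), ?_⟩
    unfold HasPVLim
    have : Tendsto (fun δ => ∫ y, (1/2) * ((ψ (z + y) + ψ (z - y) - 2 * ψ z) * kerT d j δ y))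
        (𝓝[>] (0:ℝ)) (𝓝 (∫ y, (1/2) * ((ψ (z + y) + ψ (z - y) - 2 * ψ z) * j ‖y‖))) := by
      refine tendsto_integral_filter_of_dominated_convergence _ ?_ ?_ (h.int.norm.const_mul B) ?_
      · filter_upwards [self_mem_nhdsWithin] with δ hδ
        have := h.ker_meas (δ := δ) hδ
        apply Measurable.aestronglyMeasurable
        fun_prop
      · filter_upwards [self_mem_nhdsWithin] with δ hδ
        exact Eventually.of_forall (hdom δ hδ z)
      · refine Eventually.of_forall fun y => ?_
        by_cases hy : y = 0
        · subst hy
          have : ψ z + ψ z - 2 * ψ z = 0 := by ring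
          simp [this]
        · apply tendsto_const_nhds.congr'
          have : ∀ᶠ δ in 𝓝[>] (0:ℝ), δ < ‖y‖ :=
            nhdsWithin_le_nhds (Iio_mem_nhds (norm_pos_iff.2 hy))
          filter_upwards [this] with δ hδ
          simp [kerT, hδ]
    refine this.congr' ?_
    filter_upwards [self_mem_nhdsWithin] with δ hδ
    exact (h.truncL_symm hδ hm hM' z).symm
end

section
variable {d : ℕ} {j : ℝ → ℝ} {κ : ℝ}

/-- Convolution with a mollifier. -/
def cv (ρ h : EE d → ℝ) (x : EE d) : ℝ := ∫ t, ρ t * h (x - t)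

/-- Properties of a mollifier. -/
structure Moll (ρ : EE d → ℝ) : Prop where
  nonneg : ∀ x, 0 ≤ ρ x
  even : ∀ x, ρ (-x) = ρ x
  cd : ContDiff ℝ (⊤ : ℕ∞) ρ
  cs : HasCompactSupport ρ
  supp : ∀ x, 1 < ‖x‖ → ρ x = 0
  one : ∫ x, ρ x = 1

lemma Moll.int {ρ : EE d → ℝ} (m : Moll ρ) : Integrable ρ :=
  m.cd.continuous.integrable_of_hasCompactSupport m.cs

lemma Moll.meas {ρ : EE d → ℝ} (m : Moll ρ) : Measurable ρ := m.cd.continuous.measurable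

lemma cv_meas {ρ θ : EE d → ℝ} (hρ : Measurable ρ) (hθ : Measurable θ) : Measurable (cv ρ θ) := by
  have : StronglyMeasurable (Function.uncurry fun (x t : EE d) => ρ t * θ (x - t)) := by
    apply Measurable.stronglyMeasurable
    unfold Function.uncurry
    fun_prop
  exact this.integral_prod_right.measurable

lemma JK.cv_bound (h : JK d j κ) : ∃ C1 > 0, ∀ (ρ : EE d → ℝ), Moll ρ → ∀ (θ : EE d → ℝ) (C : ℝ),
    (∀ x, |θ x| ≤ C * WW d j x) → ∀ x, |cv ρ θ x| ≤ C * C1 * WW d j x := by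
  obtain ⟨C1, hC1, H1⟩ := h.W_shift 1
  refine ⟨C1, hC1, fun ρ m θ C hθ x => ?_⟩
  have hC : 0 ≤ C := by
    have h1 := (abs_nonneg _).trans (hθ 0)
    have h2 := h.W_pos (0 : EE d)
    exact nonneg_of_mul_nonneg_left h1 h2
  have : ‖cv ρ θ x‖ ≤ ∫ t, ρ t * (C * C1 * WW d j x) := by
    refine norm_integral_le_of_norm_le (m.int.mul_const _) (Eventually.of_forall fun t => ?_)
    rw [norm_mul, Real.norm_of_nonneg (m.nonneg t), Real.norm_eq_abs]
    by_cases ht : 1 < ‖t‖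
    · simp [m.supp t ht]
    · have := H1 (x - t) x (by simpa using ht)
      have h3 := m.nonneg t
      gcongr
      rw [mul_assoc]
      exact (hθ _).trans (by gcongr)
  rw [integral_mul_const, m.one, one_mul] at this
  exact this

lemma JK.dual (h : JK d j κ) {ρ : EE d → ℝ} (m : Moll ρ) {H θ : EE d → ℝ} {C : ℝ}
    (hHm : AEStronglyMeasurable H) (hH : Integrable (fun x => H x * WW d j x))
    (hθm : Measurable θ) (hθ : ∀ x, |θ x| ≤ C * WW d j x) :
    Integrable (fun x => cv ρ H x * θ x) ∧
      ∫ x, cv ρ H x * θ x = ∫ x, H x * cv ρ θ x := by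
  obtain ⟨C1, hC1, H1⟩ := h.W_shift 1
  have hC : 0 ≤ C := by
    have h1 := (abs_nonneg _).trans (hθ 0)
    have h2 := h.W_pos (0 : EE d)
    exact nonneg_of_mul_nonneg_left h1 h2
  have hρm := m.meas
  have key : ∀ x t, ‖ρ t * θ (x + t)‖ ≤ ρ t * (C * C1 * WW d j x) := by
    intro x t
    rw [norm_mul, Real.norm_of_nonneg (m.nonneg t), Real.norm_eq_abs]
    by_cases ht : 1 < ‖t‖
    · simp [m.supp t ht]
    · have := H1 (x + t) x (by simpa using ht)
      have h3 := m.nonneg t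
      gcongr
      rw [mul_assoc]
      exact (hθ _).trans (by gcongr)
  have iF : Integrable (fun p : EE d × EE d => ρ p.2 * H (p.1 - p.2) * θ p.1)
      (volume.prod volume) := by
    have i0 := (m.int.convolution_integrand (ContinuousLinearMap.lsmul ℝ ℝ) hH.norm).const_mul (C * C1)
    refine Integrable.mono' i0 ?_ (Eventually.of_forall fun p => ?_)
    · have := AEStronglyMeasurable.convolution_integrand (ContinuousLinearMap.lsmul ℝ ℝ)
        (m.int.aestronglyMeasurable) hHm
      exact this.mul (hθm.comp measurable_fst).aestronglyMeasurable
    · have := key (p.1 - p.2) p.2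
      rw [sub_add_cancel] at this
      have hW := h.W_pos (p.1 - p.2)
      calc ‖ρ p.2 * H (p.1 - p.2) * θ p.1‖ = ‖H (p.1 - p.2)‖ * ‖ρ p.2 * θ p.1‖ := by
            simp only [norm_mul]; ring
        _ ≤ _ := mul_le_mul_of_nonneg_left this (norm_nonneg _)
        _ = _ := by
          simp only [ContinuousLinearMap.lsmul_apply, smul_eq_mul, norm_mul]
          rw [Real.norm_of_nonneg hW.le]; ring
  have iG : Integrable (fun p : EE d × EE d => ρ p.1 * H p.2 * θ (p.2 + p.1))
      (volume.prod volume) := by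
    have i0 := (m.int.mul_prod hH.norm).const_mul (C * C1)
    refine Integrable.mono' i0 ?_ (Eventually.of_forall fun p => ?_)
    · refine ((m.int.aestronglyMeasurable.comp_fst).mul hHm.comp_snd).mul ?_
      apply Measurable.aestronglyMeasurable
      fun_prop
    · have := key p.2 p.1
      have hW := h.W_pos p.2
      calc ‖ρ p.1 * H p.2 * θ (p.2 + p.1)‖ = ‖H p.2‖ * ‖ρ p.1 * θ (p.2 + p.1)‖ := by
            simp only [norm_mul]; ring
        _ ≤ _ := mul_le_mul_of_nonneg_left this (norm_nonneg _)
        _ = _ := by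
          simp only [norm_mul]
          rw [Real.norm_of_nonneg hW.le]; ring
  have e0 : ∀ x, cv ρ H x * θ x = ∫ t, ρ t * H (x - t) * θ x := by
    intro x; rw [integral_mul_const]; rfl
  refine ⟨?_, ?_⟩
  · simp_rw [e0]; exact iF.integral_prod_left
  · simp_rw [e0]
    rw [integral_integral_swap iF]
    have e1 : ∀ t, ∫ x, ρ t * H (x - t) * θ x = ∫ x, ρ t * H x * θ (x + t) := by
      intro t
      rw [← integral_sub_right_eq_self (fun x => ρ t * H x * θ (x + t)) t]
      simp
    simp_rw [e1]
    rw [integral_integral_swap iG]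
    congr 1; funext x
    unfold cv
    rw [← integral_const_mul, ← integral_neg_eq_self]
    congr 1; funext t
    rw [m.even, sub_eq_add_neg]; ring

lemma JK.comm (h : JK d j κ) {ρ : EE d → ℝ} (m : Moll ρ) {δ : ℝ} (hδ : 0 < δ) {η : EE d → ℝ}
    (hη : Measurable η) {M : ℝ} (hM : ∀ x, |η x| ≤ M) (z : EE d) :
    truncL d j (cv ρ η) z δ = cv ρ (fun x => truncL d j η x δ) z := by
  have hρm := m.meas
  rw [truncL_eq]
  unfold cv
  simp_rw [truncL_eq]
  have ib : ∀ x, Integrable (fun t => ρ t * η (x - t)) := by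
    intro x
    refine m.int.mul_bdd (c := M) ?_ (Eventually.of_forall fun t => hM _)
    apply Measurable.aestronglyMeasurable; fun_prop
  have iF : Integrable (fun p : EE d × EE d =>
      ρ p.2 * (η (z - p.2 + p.1) - η (z - p.2)) * kerT d j δ p.1) (volume.prod volume) := by
    have := (h.ker_int (δ := δ) hδ).mul_prod m.int
    have := this.mul_bdd (c := 2 * M) (g := fun p : EE d × EE d => η (z - p.2 + p.1) - η (z - p.2))
      (by apply Measurable.aestronglyMeasurable; fun_prop) (Eventually.of_forall fun p => by
        have h1 := hM (z - p.2 + p.1)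
        have h2 := hM (z - p.2)
        have := abs_sub (η (z - p.2 + p.1)) (η (z - p.2))
        rw [Real.norm_eq_abs]; linarith)
    refine this.congr (Eventually.of_forall fun p => ?_)
    simp only; ring
  have e1 : ∀ y, ((∫ t, ρ t * η (z + y - t)) - ∫ t, ρ t * η (z - t)) * kerT d j δ y =
      ∫ t, ρ t * (η (z - t + y) - η (z - t)) * kerT d j δ y := by
    intro y
    rw [← integral_sub (ib _) (ib _), ← integral_mul_const]
    congr 1; funext t
    rw [show z + y - t = z - t + y by abel]; ring
  simp_rw [e1]
  rw [integral_integral_swap iF]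
  congr 1; funext t
  rw [← integral_const_mul]
  congr 1; funext y; ring

/-- Pratt's generalised dominated convergence. -/
lemma pratt {α : Type*} [MeasurableSpace α] {μ : Measure α} {a : ℕ → α → ℝ} {a0 : α → ℝ}
    {b : ℕ → α → ℝ} {b0 : α → ℝ} (ham : ∀ n, AEStronglyMeasurable (a n) μ)
    (hb : ∀ n, Integrable (b n) μ) (hb0 : Integrable b0 μ)
    (hab : ∀ n, ∀ᵐ x ∂μ, |a n x| ≤ b n x)
    (hal : ∀ᵐ x ∂μ, Tendsto (fun n => a n x) atTop (𝓝 (a0 x)))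
    (hbl : ∀ᵐ x ∂μ, Tendsto (fun n => b n x) atTop (𝓝 (b0 x)))
    (hint : Tendsto (fun n => ∫ x, b n x ∂μ) atTop (𝓝 (∫ x, b0 x ∂μ))) :
    Tendsto (fun n => ∫ x, a n x ∂μ) atTop (𝓝 (∫ x, a0 x ∂μ)) := by
  have hab' := ae_all_iff.2 hab
  have hai : ∀ n, Integrable (a n) μ := fun n => (hb n).mono' (ham n) (hab n)
  have hle : ∀ᵐ x ∂μ, |a0 x| ≤ b0 x := by
    filter_upwards [hab', hal, hbl] with x h1 h2 h3
    exact le_of_tendsto_of_tendsto' h2.abs h3 h1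
  have imin : ∀ n, Integrable (fun x => min (b n x) (b0 x)) μ := fun n => (hb n).inf hb0
  have iclip : ∀ n, Integrable (fun x => max (-b0 x) (min (b0 x) (a n x))) μ :=
    fun n => hb0.neg.sup (hb0.inf (hai n))
  -- minima converge
  have hmin : Tendsto (fun n => ∫ x, min (b n x) (b0 x) ∂μ) atTop (𝓝 (∫ x, b0 x ∂μ)) := by
    refine tendsto_integral_of_dominated_convergence b0
      (fun n => ((hb n).inf hb0).aestronglyMeasurable) hb0 (fun n => ?_) ?_
    · filter_upwards [hab n, hle] with x h1 h2
      have := (abs_nonneg _).trans h1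
      have := (abs_nonneg _).trans h2
      rw [Real.norm_of_nonneg (by positivity)]
      exact min_le_right _ _
    · filter_upwards [hbl] with x hx
      simpa using hx.min (tendsto_const_nhds (x := b0 x))
  have hclip : Tendsto (fun n => ∫ x, max (-b0 x) (min (b0 x) (a n x)) ∂μ) atTop
      (𝓝 (∫ x, a0 x ∂μ)) := by
    refine tendsto_integral_of_dominated_convergence b0
      (fun n => (hb0.neg.sup (hb0.inf (hai n))).aestronglyMeasurable) hb0 (fun n => ?_) ?_
    · filter_upwards [hle] with x h2
      have := (abs_nonneg _).trans h2
      rw [Real.norm_eq_abs, abs_le]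
      exact ⟨le_max_left _ _, max_le (by linarith) (min_le_left _ _)⟩
    · filter_upwards [hle, hal] with x h2 hx
      have h3 := (tendsto_const_nhds (x := -b0 x)).max ((tendsto_const_nhds (x := b0 x)).min hx)
      rw [abs_le] at h2
      rwa [min_eq_right h2.2, max_eq_right h2.1] at h3
  have hdiff : Tendsto (fun n => ∫ x, (a n x - max (-b0 x) (min (b0 x) (a n x))) ∂μ) atTop
      (𝓝 0) := by
    refine squeeze_zero_norm (a := fun n => (∫ x, b n x ∂μ) - ∫ x, min (b n x) (b0 x) ∂μ)
      (fun n => ?_) (by simpa using hint.sub hmin)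
    rw [← integral_sub (hb n) (imin n)]
    refine norm_integral_le_of_norm_le ((hb n).sub (imin n)) ?_
    filter_upwards [hab n, hle] with x h1 h2
    have h0 := (abs_nonneg _).trans h2
    rw [abs_le] at h1
    rw [Real.norm_eq_abs, abs_le]
    rcases max_cases (-b0 x) (min (b0 x) (a n x)) with h3 | h3 <;>
    rcases min_cases (b0 x) (a n x) with h4 | h4 <;>
    rcases min_cases (b n x) (b0 x) with h5 | h5 <;> constructor <;> linarith
  have := hdiff.add hclip
  rw [zero_add] at this
  refine this.congr fun n => ?_
  rw [integral_sub (hai n) (iclip n)]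
  ring
end

section
variable {d : ℕ} {j : ℝ → ℝ} {κ : ℝ}

lemma cv_eq_conv (ρ h : EE d → ℝ) :
    cv ρ h = MeasureTheory.convolution ρ h (ContinuousLinearMap.lsmul ℝ ℝ) volume := rfl

lemma Moll.cv_contDiff {ρ H : EE d → ℝ} (m : Moll ρ) (hH : LocallyIntegrable H) :
    ContDiff ℝ (⊤ : ℕ∞) (cv ρ H) := by
  rw [cv_eq_conv]
  exact m.cs.contDiff_convolution_left _ m.cd hH

lemma exists_moll (d : ℕ) : ∃ ρ : ℕ → EE d → ℝ, (∀ n, Moll (ρ n)) ∧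
    (∀ (n : ℕ) x, 1 / ((n : ℝ) + 1) < ‖x‖ → ρ n x = 0) ∧
    ∀ g : EE d → ℝ, LocallyIntegrable g →
      ∀ᵐ x, Tendsto (fun n => cv (ρ n) g x) atTop (𝓝 (g x)) := by
  let φ : ℕ → ContDiffBump (0 : EE d) := fun n =>
    { rIn := 1 / ((n : ℝ) + 1) / 2
      rOut := 1 / ((n : ℝ) + 1)
      rIn_pos := by positivity
      rIn_lt_rOut := half_lt_self (by positivity) }
  have hs : ∀ (n : ℕ) x, 1 / ((n : ℝ) + 1) < ‖x‖ → (φ n).normed volume x = 0 := by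
    intro n x hx
    by_contra hne
    have : x ∈ Function.support ((φ n).normed volume) := hne
    rw [ContDiffBump.support_normed_eq] at this
    have h2 : ‖x‖ < 1 / ((n : ℝ) + 1) := by
      rw [mem_ball_zero_iff] at this
      exact this
    linarith
  refine ⟨fun n => (φ n).normed volume, fun n => ⟨?_, ?_, ?_, ?_, ?_, ?_⟩, hs, fun g hg => ?_⟩
  · exact (φ n).nonneg_normed
  · exact (φ n).normed_neg
  · exact (φ n).contDiff_normed
  · exact (φ n).hasCompactSupport_normed
  · intro x hx
    refine hs n x (lt_of_le_of_lt ?_ hx)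
    rw [div_le_one (by positivity)]
    have : (0:ℝ) ≤ n := by positivity
    linarith
  · exact (φ n).integral_normed
  · exact ContDiffBump.ae_convolution_tendsto_right_of_locallyIntegrable (φ := φ) (K := 2)
      tendsto_one_div_add_atTop_nhds_zero_nat (Eventually.of_forall fun n => by simp only [φ]; linarith) hg

lemma JK.locInt (h : JK d j κ) {H : EE d → ℝ}
    (hH : Integrable (fun x => H x * WW d j x)) : LocallyIntegrable H := by
  rw [locallyIntegrable_iff]
  intro K hK
  obtain ⟨R, hR⟩ := hK.isBounded.subset_closedBall (0 : EE d)
  have hc := h.pos (max R 1) (lt_max_of_lt_right one_pos)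
  have : IntegrableOn (fun x => (H x * WW d j x) * (WW d j x)⁻¹) K := by
    refine hH.integrableOn.mul_bdd (c := (j (max R 1))⁻¹) h.W_meas.inv.aestronglyMeasurable ?_
    filter_upwards [ae_restrict_mem hK.measurableSet] with x hx
    have hW := h.W_pos x
    rw [norm_inv, Real.norm_of_nonneg hW.le]
    gcongr
    apply h.le (lt_max_of_lt_right one_pos)
    have : ‖x‖ ≤ R := by simpa using hR hx
    gcongr
  refine this.congr_fun (fun x _ => ?_) hK.measurableSet
  have hW := h.W_pos x
  simp only; field_simp

lemma JK.bdd_locInt (h : JK d j κ) {θ : EE d → ℝ} {C : ℝ} (hθm : Measurable θ)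
    (hθ : ∀ x, |θ x| ≤ C * WW d j x) : LocallyIntegrable θ := by
  have hC : 0 ≤ C := by
    have h1 := (abs_nonneg _).trans (hθ 0)
    exact nonneg_of_mul_nonneg_left h1 (h.W_pos (0 : EE d))
  refine (locallyIntegrable_const (C * j 1)).mono hθm.aestronglyMeasurable
    (Eventually.of_forall fun x => ?_)
  have h1 := h.pos 1 one_pos
  rw [Real.norm_eq_abs, Real.norm_of_nonneg (by positivity)]
  exact (hθ x).trans (mul_le_mul_of_nonneg_left (h.W_le x) hC)

lemma JK.mul_int (h : JK d j κ) {H θ : EE d → ℝ} {C : ℝ}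
    (hH : Integrable (fun x => H x * WW d j x))
    (hθm : AEStronglyMeasurable θ) (hθ : ∀ x, |θ x| ≤ C * WW d j x) :
    Integrable (fun x => H x * θ x) := by
  have hHm := (h.locInt hH).aestronglyMeasurable
  refine (hH.norm.const_mul C).mono' (hHm.mul hθm) (Eventually.of_forall fun x => ?_)
  have hW := h.W_pos x
  rw [norm_mul, norm_mul, Real.norm_of_nonneg hW.le, Real.norm_eq_abs (θ x)]
  calc _ ≤ ‖H x‖ * (C * WW d j x) := mul_le_mul_of_nonneg_left (hθ x) (norm_nonneg _)
    _ = _ := by ring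

lemma JK.limG (h : JK d j κ) {ρ : ℕ → EE d → ℝ} (m : ∀ n, Moll (ρ n))
    (hl : ∀ g : EE d → ℝ, LocallyIntegrable g →
      ∀ᵐ x, Tendsto (fun n => cv (ρ n) g x) atTop (𝓝 (g x)))
    {H θ : EE d → ℝ} {C : ℝ} (hH : Integrable (fun x => H x * WW d j x))
    (hθm : Measurable θ) (hθ : ∀ x, |θ x| ≤ C * WW d j x)
    {a : ℕ → EE d → ℝ} {a0 : EE d → ℝ} (ham : ∀ n, AEStronglyMeasurable (a n))
    (hab : ∀ n x, |a n x| ≤ |cv (ρ n) H x| * |θ x|)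
    (hal : ∀ᵐ x, Tendsto (fun n => a n x) atTop (𝓝 (a0 x))) :
    Tendsto (fun n => ∫ x, a n x) atTop (𝓝 (∫ x, a0 x)) := by
  have hHm := (h.locInt hH).aestronglyMeasurable
  have hAH : Integrable (fun x => |H x| * WW d j x) := by
    refine hH.norm.congr (Eventually.of_forall fun x => ?_)
    simp only [norm_mul, Real.norm_eq_abs, abs_of_pos (h.W_pos x)]
  have hAm : AEStronglyMeasurable (fun x => |H x|) := hHm.norm
  have hθ' : ∀ x, |(|θ x|)| ≤ C * WW d j x := by simpa using hθ
  have hθm' : Measurable (fun x => |θ x|) := by fun_prop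
  have D := fun n => h.dual (m n) hAm hAH hθm' hθ'
  obtain ⟨C1, hC1, HC⟩ := h.cv_bound
  refine pratt (b := fun n x => cv (ρ n) (fun x => |H x|) x * |θ x|) (b0 := fun x => |H x| * |θ x|)
    ham (fun n => (D n).1) (h.mul_int hAH hθm'.aestronglyMeasurable hθ') (fun n => ?_) hal ?_ ?_
  · refine Eventually.of_forall fun x => (hab n x).trans ?_
    gcongr
    unfold cv
    refine (abs_integral_le_integral_abs).trans (le_of_eq ?_)
    congr 1; funext t
    rw [abs_mul, abs_of_nonneg ((m n).nonneg t)]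
  · filter_upwards [hl _ (h.locInt hAH)] with x hx
    exact hx.mul_const _
  · simp_rw [fun n => (D n).2]
    refine tendsto_integral_of_dominated_convergence (fun x => C * C1 * (|H x| * WW d j x))
      (fun n => ?_) (hAH.const_mul _) (fun n => ?_) ?_
    · exact hAm.mul (cv_meas (m n).meas hθm').aestronglyMeasurable
    · refine Eventually.of_forall fun x => ?_
      rw [norm_mul, Real.norm_eq_abs, Real.norm_eq_abs, abs_abs]
      have := HC (ρ n) (m n) _ C hθ' x
      calc _ ≤ |H x| * (C * C1 * WW d j x) := mul_le_mul_of_nonneg_left this (abs_nonneg _)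
        _ = _ := by ring
    · filter_upwards [hl _ (h.bdd_locInt hθm' hθ')] with x hx
      exact hx.const_mul _

lemma JK.Lprops (h : JK d j κ) {ψ Lψ : EE d → ℝ} (h1 : ContDiff ℝ (⊤ : ℕ∞) ψ)
    (h2 : HasCompactSupport ψ) (hL : ∀ x, HasPVLim d j ψ x (Lψ x)) :
    Measurable Lψ ∧ ∃ C, (∀ x, |Lψ x| ≤ C * WW d j x) ∧
      (∀ δ > 0, ∀ x, |truncL d j ψ x δ| ≤ C * WW d j x) := by
  have hm : Measurable ψ := h1.continuous.measurable
  obtain ⟨⟨C, hC⟩, -⟩ := h.test h1 h2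
  constructor
  · have hs : Tendsto (fun n : ℕ => 1 / ((n:ℝ) + 1)) atTop (𝓝[>] 0) := by
      refine tendsto_nhdsWithin_iff.2 ⟨tendsto_one_div_add_atTop_nhds_zero_nat,
        Eventually.of_forall fun n => ?_⟩
      simp only [mem_Ioi]; positivity
    refine measurable_of_tendsto_metrizable
      (fun n : ℕ => h.truncL_meas (δ := 1 / ((n:ℝ) + 1)) (by positivity) hm) ?_
    rw [tendsto_pi_nhds]
    intro x
    exact (hL x).comp hs
  · refine ⟨C, fun x => ?_, hC⟩
    refine le_of_tendsto (hL x).abs ?_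
    filter_upwards [self_mem_nhdsWithin] with δ hδ
    exact hC δ hδ x

lemma JK.limT (h : JK d j κ) {ψ Lψ H : EE d → ℝ} (h1 : ContDiff ℝ (⊤ : ℕ∞) ψ)
    (h2 : HasCompactSupport ψ) (hL : ∀ x, HasPVLim d j ψ x (Lψ x))
    (hH : Integrable (fun x => H x * WW d j x)) :
    Tendsto (fun δ => ∫ x, H x * truncL d j ψ x δ) (𝓝[>] 0) (𝓝 (∫ x, H x * Lψ x)) := by
  have hm : Measurable ψ := h1.continuous.measurable
  have hHm := (h.locInt hH).aestronglyMeasurable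
  obtain ⟨hLm, C, hC, hCT⟩ := h.Lprops h1 h2 hL
  refine tendsto_integral_filter_of_dominated_convergence (fun x => C * ‖H x * WW d j x‖) ?_ ?_
    (hH.norm.const_mul _) ?_
  · filter_upwards [self_mem_nhdsWithin] with δ hδ
    exact hHm.mul (h.truncL_meas hδ hm).aestronglyMeasurable
  · filter_upwards [self_mem_nhdsWithin] with δ hδ
    refine Eventually.of_forall fun x => ?_
    rw [norm_mul, norm_mul, Real.norm_of_nonneg (h.W_pos x).le, Real.norm_eq_abs (truncL _ _ _ _ _)]
    calc _ ≤ ‖H x‖ * (C * WW d j x) := mul_le_mul_of_nonneg_left (hCT δ hδ x) (norm_nonneg _)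
      _ = _ := by ring
  · exact Eventually.of_forall fun x => (hL x).const_mul _

lemma test_bdd (h : JK d j κ) {ξ : EE d → ℝ} (h1 : Continuous ξ) (h2 : HasCompactSupport ξ) :
    ∃ M R C, (∀ x, |ξ x| ≤ M) ∧ (∀ x, R < ‖x‖ → ξ x = 0) ∧ ∀ x, |ξ x| ≤ C * WW d j x := by
  obtain ⟨M, hM⟩ := h2.exists_bound_of_continuous h1
  obtain ⟨R, hR⟩ := h2.isCompact.isBounded.subset_closedBall (0 : EE d)
  have hR' : ∀ x, R < ‖x‖ → ξ x = 0 := by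
    intro x hx
    by_contra hne
    have := hR (subset_tsupport _ hne)
    simp at this; linarith
  have hM0 : 0 ≤ M := (norm_nonneg _).trans (hM 0)
  obtain ⟨C2, hC2, H2⟩ := h.W_shift (d := d) R
  refine ⟨M, R, M * (C2 * (WW d j 0)⁻¹), hM, hR', fun x => ?_⟩
  have hW := h.W_pos x
  have hW0 := h.W_pos (0 : EE d)
  by_cases hx : R < ‖x‖
  · rw [hR' x hx]; simp; positivity
  · have := H2 0 x (by simpa using hx)
    have h3 : 1 ≤ (C2 * (WW d j 0)⁻¹) * WW d j x := by
      rw [mul_assoc, inv_mul_eq_div, ← mul_div_assoc, one_le_div hW0]; exact this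
    calc |ξ x| ≤ M * 1 := by rw [mul_one]; exact hM x
      _ ≤ M * ((C2 * (WW d j 0)⁻¹) * WW d j x) := by gcongr
      _ = _ := by ring

/-- The Kato inequality for the mollified function. -/
lemma JK.key (h : JK d j κ) {ρ : EE d → ℝ} (m : Moll ρ) {w ξ Lξ η Lη : EE d → ℝ}
    (hw : Integrable (fun x => w x * WW d j x))
    (h1 : ContDiff ℝ (⊤ : ℕ∞) ξ) (h2 : HasCompactSupport ξ) (h0 : ∀ x, 0 ≤ ξ x)
    (hL : ∀ x, HasPVLim d j ξ x (Lξ x))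
    (hη : ∀ x, η x = if 0 < cv ρ w x then ξ x else 0)
    (hc1 : ContDiff ℝ (⊤ : ℕ∞) (cv ρ η)) (hc2 : HasCompactSupport (cv ρ η))
    (hLη : ∀ x, HasPVLim d j (cv ρ η) x (Lη x)) :
    ∫ x, w x * Lη x ≤ ∫ x, max (cv ρ w x) 0 * Lξ x := by
  have hwl := h.locInt hw
  have hwm := hwl.aestronglyMeasurable
  have hwc : Continuous (cv ρ w) := (m.cv_contDiff hwl).continuous
  have hξm : Measurable ξ := h1.continuous.measurable
  obtain ⟨M, R, C, hM, hR, hC⟩ := test_bdd h h1.continuous h2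
  have hηm : Measurable η := by
    rw [show η = fun x => if 0 < cv ρ w x then ξ x else 0 from funext hη]
    exact Measurable.ite (measurableSet_lt measurable_const hwc.measurable) hξm measurable_const
  have hη1 : ∀ x, 0 ≤ η x := fun x => by rw [hη]; split_ifs; exacts [h0 x, le_rfl]
  have hη2 : ∀ x, η x ≤ ξ x := fun x => by rw [hη]; split_ifs; exacts [le_rfl, h0 x]
  have hηM : ∀ x, |η x| ≤ M := fun x => by
    rw [abs_of_nonneg (hη1 x)]
    exact (hη2 x).trans ((le_abs_self _).trans (hM x))
  have hηR : ∀ x, R < ‖x‖ → η x = 0 := fun x hx =>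
    le_antisymm ((hη2 x).trans_eq (hR x hx)) (hη1 x)
  have hwW : Integrable (fun x => cv ρ w x * WW d j x) :=
    (h.dual m hwm hw h.W_meas (C := 1) (fun x => by rw [abs_of_pos (h.W_pos x), one_mul])).1
  have hpW : Integrable (fun x => max (cv ρ w x) 0 * WW d j x) := by
    refine hwW.mono ((hwc.max continuous_const).aestronglyMeasurable.mul
      h.W_meas.aestronglyMeasurable) (Eventually.of_forall fun x => ?_)
    rw [norm_mul, norm_mul]
    gcongr
    rw [Real.norm_eq_abs, Real.norm_eq_abs, abs_of_nonneg (le_max_right _ _)]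
    exact max_le (le_abs_self _) (abs_nonneg _)
  refine le_of_tendsto_of_tendsto (h.limT hc1 hc2 hLη hw) (h.limT h1 h2 hL hpW) ?_
  filter_upwards [self_mem_nhdsWithin] with δ hδ
  have hδ : 0 < δ := hδ
  obtain ⟨C3, hC3⟩ := h.conv_bdd hδ hηm hηM hηR
  obtain ⟨C4, hC4⟩ := h.conv_bdd hδ hξm hM hR
  have hT := h.truncL_meas hδ hηm
  have hD := h.dual m hwm hw hT hC3
  simp_rw [h.comm m hδ hηm hηM]
  rw [← hD.2]
  refine integral_mono hD.1
    (h.mul_int hpW (h.truncL_meas hδ hξm).aestronglyMeasurable hC4) fun x => ?_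
  simp only
  rw [truncL_eq, truncL_eq]
  have iη := h.bdd_ker_int hδ (η := fun y => η (x + y) - η x) (by fun_prop) (M := 2 * M) (fun y => by
    have := abs_sub (η (x + y)) (η x)
    linarith [hηM (x + y), hηM x])
  have iξ := h.bdd_ker_int hδ (η := fun y => ξ (x + y) - ξ x) (by fun_prop) (M := 2 * M) (fun y => by
    have := abs_sub (ξ (x + y)) (ξ x)
    linarith [hM (x + y), hM x])
  by_cases hx : 0 < cv ρ w x
  · rw [max_eq_left hx.le]
    gcongr 1
    refine integral_mono iη iξ fun y => ?_
    have : η x = ξ x := by rw [hη, if_pos hx]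
    simp only [this]
    have := h.ker_nonneg hδ y
    gcongr
    exact hη2 _
  · push Not at hx
    rw [max_eq_right hx, zero_mul]
    have : η x = 0 := by rw [hη, if_neg (not_lt.2 hx)]
    refine mul_nonpos_of_nonpos_of_nonneg hx (integral_nonneg fun y => ?_)
    simp only [this, sub_zero]
    exact mul_nonneg (hη1 _) (h.ker_nonneg hδ y)
end

section
variable {d : ℕ} {j : ℝ → ℝ} {κ : ℝ}

lemma JK.weight (h : JK d j κ) (hd : 2 ≤ d) {u : EE d → ℝ}
    (hu : Integrable (fun x => u x * min 1 (j ‖x‖))) :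
    Integrable (fun x => u x * WW d j x) := by
  have : Nonempty (Fin d) := ⟨⟨0, by omega⟩⟩
  have hne : ∀ᵐ x : EE d, x ≠ 0 := by
    rw [ae_iff]; simp
  have hjm : AEStronglyMeasurable (fun x : EE d => j ‖x‖) := by
    have h1 : AEStronglyMeasurable (fun x : EE d => (min 1 (‖x‖ ^ 2))⁻¹ * (min 1 (‖x‖ ^ 2) * j ‖x‖)) := by
      refine AEStronglyMeasurable.mul ?_ h.int.aestronglyMeasurable
      apply Measurable.aestronglyMeasurable
      fun_prop
    refine h1.congr ?_
    filter_upwards [hne] with x hx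
    have : 0 < ‖x‖ := norm_pos_iff.2 hx
    have : 0 < min 1 (‖x‖^2) := by positivity
    field_simp
  have h1 := h.pos 1 one_pos
  have hqm : AEStronglyMeasurable (fun x : EE d => (min 1 (j ‖x‖))⁻¹ * WW d j x) := by
    refine AEStronglyMeasurable.mul ?_ h.W_meas.aestronglyMeasurable
    exact ((aemeasurable_const.min hjm.aemeasurable).inv).aestronglyMeasurable
  have := hu.mul_bdd (c := max 1 (j 1)) hqm (by
    filter_upwards [hne] with x hx
    have hx0 : 0 < ‖x‖ := norm_pos_iff.2 hx
    have hj := h.pos _ hx0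
    have hW := h.W_pos x
    rw [Real.norm_of_nonneg (by positivity), inv_mul_le_iff₀ (by positivity)]
    have b1 : WW d j x ≤ j 1 := h.W_le x
    have b2 : WW d j x ≤ j ‖x‖ := h.le hx0 (le_max_left _ _)
    have b3 : (1:ℝ) ≤ max 1 (j 1) := le_max_left _ _
    have b4 : j 1 ≤ max 1 (j 1) := le_max_right _ _
    rcases min_cases 1 (j ‖x‖) with hc | hc
    · rw [hc.1]; linarith
    · rw [hc.1]; nlinarith)
  refine this.congr ?_
  filter_upwards [hne] with x hx
  have hx0 : 0 < ‖x‖ := norm_pos_iff.2 hx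
  have hj := h.pos _ hx0
  have : 0 < min 1 (j ‖x‖) := by positivity
  field_simp

lemma testInt {Ω : Set (EE d)} {f ψ : EE d → ℝ} (hf : LocallyIntegrableOn f Ω)
    (hψ : IsTestOn d Ω ψ) : Integrable (fun x => f x * ψ x) (volume.restrict Ω) := by
  obtain ⟨h1, h2, h3⟩ := hψ
  have hK : IsCompact (tsupport ψ) := h2
  have h4 : IntegrableOn f (tsupport ψ) := hf.integrableOn_compact_subset h3 hK
  obtain ⟨M, hM⟩ := h2.exists_bound_of_continuous h1.continuous
  have h5 : IntegrableOn (fun x => f x * ψ x) (tsupport ψ) :=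
    h4.mul_bdd (c := M) h1.continuous.aestronglyMeasurable (Eventually.of_forall hM)
  refine Integrable.mono_measure ?_ (Measure.restrict_le_self (s := Ω))
  refine (integrableOn_iff_integrable_of_support_subset ?_).1 h5
  intro x hx
  apply subset_tsupport
  intro h0
  exact hx (by simp [h0])

/-- The nonlocal Kato inequality. -/
lemma JK.kato (h : JK d j κ) {Ω : Set (EE d)} (hΩ : IsOpen Ω) {w f : EE d → ℝ}
    (hw : Integrable (fun x => w x * WW d j x)) (hf : LocallyIntegrableOn f Ω)
    (hwf : ∀ x, w x = 0 → f x = 0)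
    (sol : ∀ ξ Lξ : EE d → ℝ, IsTestOn d Ω ξ → (∀ x, HasPVLim d j ξ x (Lξ x)) →
      ∫ x, w x * Lξ x = ∫ x in Ω, f x * ξ x)
    {ξ Lξ : EE d → ℝ} (hξ : IsTestOn d Ω ξ) (h0 : ∀ x, 0 ≤ ξ x)
    (hL : ∀ x, HasPVLim d j ξ x (Lξ x)) :
    ∫ x in Ω, (if 0 < w x then f x else 0) * ξ x ≤ ∫ x, max (w x) 0 * Lξ x := by
  obtain ⟨h1, h2, h3⟩ := hξ
  have hwl := h.locInt hw
  obtain ⟨M, R, C, hM, hR, hC⟩ := test_bdd h h1.continuous h2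
  obtain ⟨hLm, CL, hCL, -⟩ := h.Lprops h1 h2 hL
  obtain ⟨ρ, m, hs, hl⟩ := exists_moll d
  have hK : IsCompact (tsupport ξ) := h2
  obtain ⟨ε, hε, hεΩ⟩ := hK.exists_cthickening_subset_open hΩ h3
  set K' := Metric.cthickening ε (tsupport ξ) with hK'def
  have hK' : IsCompact K' := hK.cthickening
  have hKK' : tsupport ξ ⊆ K' := Metric.self_subset_cthickening _
  have hξm : Measurable ξ := h1.continuous.measurable
  set F := K'.indicator f with hF
  have hFi : Integrable F :=
    (integrable_indicator_iff hK'.measurableSet).2 (hf.integrableOn_compact_subset hεΩ hK')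
  have hFW : Integrable (fun x => F x * WW d j x) :=
    hFi.mul_bdd (c := j 1) h.W_meas.aestronglyMeasurable (Eventually.of_forall fun x => by
      rw [Real.norm_of_nonneg (h.W_pos x).le]; exact h.W_le x)
  let η : ℕ → EE d → ℝ := fun n x => if 0 < cv (ρ n) w x then ξ x else 0
  have hwc : ∀ n, Continuous (cv (ρ n) w) := fun n => ((m n).cv_contDiff hwl).continuous
  have hηm : ∀ n, Measurable (η n) := fun n =>
    Measurable.ite (measurableSet_lt measurable_const (hwc n).measurable) hξm measurable_const
  have hηle : ∀ n x, |η n x| ≤ |ξ x| := by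
    intro n x
    simp only [η]
    split_ifs
    · exact le_rfl
    · simp
  have hηC : ∀ n x, |η n x| ≤ C * WW d j x := fun n x => (hηle n x).trans (hC x)
  -- inequality for large n
  have ineq : ∀ᶠ n : ℕ in atTop,
      ∫ x, cv (ρ n) F x * η n x ≤ ∫ x, max (cv (ρ n) w x) 0 * Lξ x := by
    have hsm : ∀ᶠ n : ℕ in atTop, 1 / ((n:ℝ) + 1) < ε :=
      tendsto_one_div_add_atTop_nhds_zero_nat.eventually (gt_mem_nhds hε)
    filter_upwards [hsm] with n hn
    have hsupp : ∀ x, x ∉ K' → cv (ρ n) (η n) x = 0 := by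
      intro x hx
      unfold cv
      rw [integral_eq_zero_of_ae]
      refine Eventually.of_forall fun t => ?_
      simp only [Pi.zero_apply]
      by_cases ht : 1 / ((n:ℝ) + 1) < ‖t‖
      · rw [hs n t ht, zero_mul]
      · have : ξ (x - t) = 0 := by
          by_contra hne
          apply hx
          refine Metric.mem_cthickening_of_dist_le x (x - t) ε _ (subset_tsupport _ hne) ?_
          rw [dist_eq_norm]; simp only [sub_sub_cancel]; linarith
        have h5 := hηle n (x - t)
        rw [this, abs_zero] at h5
        rw [abs_nonpos_iff.1 h5, mul_zero]
    have hts : tsupport (cv (ρ n) (η n)) ⊆ K' := by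
      refine closure_minimal (fun x hx => ?_) hK'.isClosed
      by_contra hx'
      exact hx (hsupp x hx')
    have hc2 : HasCompactSupport (cv (ρ n) (η n)) := hK'.of_isClosed_subset (isClosed_tsupport _) hts
    have hc1 := (m n).cv_contDiff (h.bdd_locInt (hηm n) (hηC n))
    choose Lη hLη using (h.test hc1 hc2).2
    have hkey := h.key (m n) hw h1 h2 h0 hL (η := η n) (fun x => rfl) hc1 hc2 hLη
    rw [sol _ Lη ⟨hc1, hc2, hts.trans hεΩ⟩ hLη] at hkey
    rw [(h.dual (m n) hFi.aestronglyMeasurable hFW (hηm n) (hηC n)).2]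
    refine le_trans (le_of_eq ?_) hkey
    rw [← integral_indicator hΩ.measurableSet]
    congr 1; funext x
    by_cases hx : x ∈ K'
    · simp [hF, hx, hεΩ hx]
    · simp [hF, hx, hsupp x hx, Set.indicator]
  have lim1 : Tendsto (fun n => ∫ x, max (cv (ρ n) w x) 0 * Lξ x) atTop
      (𝓝 (∫ x, max (w x) 0 * Lξ x)) := by
    refine h.limG m hl hw hLm hCL (fun n => ?_) (fun n x => ?_) ?_
    · exact ((hwc n).max continuous_const).aestronglyMeasurable.mul hLm.aestronglyMeasurable
    · rw [abs_mul]
      refine mul_le_mul_of_nonneg_right ?_ (abs_nonneg _)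
      rw [abs_of_nonneg (le_max_right _ _)]
      exact max_le (le_abs_self _) (abs_nonneg _)
    · filter_upwards [hl w hwl] with x hx
      exact (hx.max tendsto_const_nhds).mul_const _
  have lim2 : Tendsto (fun n => ∫ x, cv (ρ n) F x * η n x) atTop
      (𝓝 (∫ x, (if 0 < w x then F x else 0) * ξ x)) := by
    have hFc : ∀ n, Continuous (cv (ρ n) F) := fun n =>
      ((m n).cv_contDiff hFi.locallyIntegrable).continuous
    refine h.limG m hl hFW hξm hC (fun n => ?_) (fun n x => ?_) ?_
    · exact (hFc n).aestronglyMeasurable.mul (hηm n).aestronglyMeasurable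
    · rw [abs_mul]
      exact mul_le_mul_of_nonneg_left (hηle n x) (abs_nonneg _)
    · filter_upwards [hl w hwl, hl F hFi.locallyIntegrable] with x hx hFx
      rcases lt_trichotomy (w x) 0 with hneg | hz | hpos
      · rw [if_neg hneg.not_gt, zero_mul]
        apply tendsto_const_nhds.congr'
        filter_upwards [hx.eventually (gt_mem_nhds hneg)] with n hn
        simp [η, not_lt.2 hn.le]
      · have hF0 : F x = 0 := by
          simp only [hF, Set.indicator]
          split_ifs
          · exact hwf x hz
          · rfl
        rw [hz, if_neg (lt_irrefl _), zero_mul]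
        rw [hF0] at hFx
        refine squeeze_zero_norm (a := fun n => |cv (ρ n) F x| * |ξ x|) (fun n => ?_) ?_
        · rw [norm_mul]
          exact mul_le_mul_of_nonneg_left (hηle n x) (abs_nonneg _)
        · simpa using hFx.abs.mul_const (|ξ x|)
      · rw [if_pos hpos]
        refine (hFx.mul_const (ξ x)).congr' ?_
        filter_upwards [hx.eventually (lt_mem_nhds hpos)] with n hn
        simp [η, hn]
  refine le_trans (le_of_eq ?_) (le_of_tendsto_of_tendsto lim2 lim1 ineq)
  rw [← integral_indicator hΩ.measurableSet]
  congr 1; funext x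
  by_cases hx : x ∈ K'
  · simp [hF, hx, hεΩ hx]
  · have : ξ x = 0 := by
      by_contra hne
      exact hx (hKK' (subset_tsupport _ hne))
    simp [this, Set.indicator]
end

/-- The maximum of two distributional solutions is a distributional subsolution,
and the minimum is a distributional supersolution. -/
theorem max_subsolution_min_supersolution
    (d : ℕ) (hd : 2 ≤ d)
    (j : ℝ → ℝ) (hjpos : ∀ r > 0, 0 < j r) (hjanti : AntitoneOn j (Set.Ioi 0))
    (hjint : Integrable (fun y : EuclideanSpace ℝ (Fin d) => min 1 (‖y‖ ^ 2) * j ‖y‖))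
    (κ : ℝ) (hκ : 1 ≤ κ) (hjdoub : ∀ r > 0, j r ≤ κ * j (2 * r))
    (Ω : Set (EuclideanSpace ℝ (Fin d))) (hΩo : IsOpen Ω) (hΩb : Bornology.IsBounded Ω)
    (g : ℝ → ℝ) (hgcont : Continuous g) (hgmono : Monotone g)
    (u v : EuclideanSpace ℝ (Fin d) → ℝ)
    (huL1 : Integrable (fun x => u x * min 1 (j ‖x‖)))
    (hvL1 : Integrable (fun x => v x * min 1 (j ‖x‖)))
    (hgu : LocallyIntegrableOn (fun x => g (u x)) Ω)
    (hgv : LocallyIntegrableOn (fun x => g (v x)) Ω)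
    (husol : ∀ (ξ Lξ : EuclideanSpace ℝ (Fin d) → ℝ), IsTestOn d Ω ξ →
      (∀ x, HasPVLim d j ξ x (Lξ x)) →
      -∫ x, u x * Lξ x = -∫ x in Ω, g (u x) * ξ x)
    (hvsol : ∀ (ξ Lξ : EuclideanSpace ℝ (Fin d) → ℝ), IsTestOn d Ω ξ →
      (∀ x, HasPVLim d j ξ x (Lξ x)) →
      -∫ x, v x * Lξ x = -∫ x in Ω, g (v x) * ξ x) :
    ∀ (ξ Lξ : EuclideanSpace ℝ (Fin d) → ℝ), IsTestOn d Ω ξ → (∀ x, 0 ≤ ξ x) →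
      (∀ x, HasPVLim d j ξ x (Lξ x)) →
      (-∫ x, max (u x) (v x) * Lξ x ≤ -∫ x in Ω, g (max (u x) (v x)) * ξ x) ∧
      (-∫ x in Ω, g (min (u x) (v x)) * ξ x ≤ -∫ x, min (u x) (v x) * Lξ x) := by
  intro ξ Lξ hξ h0 hL
  have h : JK d j κ := ⟨hjpos, hjanti, hjint, hκ, hjdoub⟩
  have hu := h.weight hd huL1
  have hv := h.weight hd hvL1
  obtain ⟨h1, h2, h3⟩ := id hξ
  have hw : Integrable (fun x => (u x - v x) * WW d j x) := by
    refine (hu.sub hv).congr (Eventually.of_forall fun x => ?_)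
    simp only [Pi.sub_apply]; ring
  have hintL : ∀ {ψ Lψ H : EE d → ℝ}, IsTestOn d Ω ψ → (∀ x, HasPVLim d j ψ x (Lψ x)) →
      Integrable (fun x => H x * WW d j x) → Integrable (fun x => H x * Lψ x) := by
    intro ψ Lψ H hψ hLψ hH
    obtain ⟨hm, C, hC, -⟩ := h.Lprops hψ.1 hψ.2.1 hLψ
    exact h.mul_int hH hm.aestronglyMeasurable hC
  have hk := h.kato hΩo (w := fun x => u x - v x) (f := fun x => g (u x) - g (v x)) hw
    (hgu.sub hgv) (fun x hx => by rw [sub_eq_zero.1 hx, sub_self]) (by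
      intro ψ Lψ hψ hLψ
      have e1 := neg_inj.1 (husol ψ Lψ hψ hLψ)
      have e2 := neg_inj.1 (hvsol ψ Lψ hψ hLψ)
      simp_rw [sub_mul]
      rw [integral_sub (hintL hψ hLψ hu) (hintL hψ hLψ hv),
        integral_sub (testInt hgu hψ) (testInt hgv hψ), e1, e2]) hξ h0 hL
  have eu := neg_inj.1 (husol ξ Lξ hξ hL)
  have ev := neg_inj.1 (hvsol ξ Lξ hξ hL)
  have hpW : Integrable (fun x => max (u x - v x) 0 * WW d j x) := by
    have hm := (h.locInt hw).aestronglyMeasurable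
    refine hw.mono ((hm.sup aestronglyMeasurable_const).mul
      h.W_meas.aestronglyMeasurable) (Eventually.of_forall fun x => ?_)
    rw [norm_mul, norm_mul]
    gcongr
    rw [Real.norm_eq_abs, Real.norm_eq_abs, abs_of_nonneg (le_max_right _ _)]
    exact max_le (le_abs_self _) (abs_nonneg _)
  have iu := hintL hξ hL hu
  have iv := hintL hξ hL hv
  have ip := hintL hξ hL hpW
  have igu := testInt hgu hξ
  have igv := testInt hgv hξ
  have igp : Integrable (fun x => (if 0 < u x - v x then g (u x) - g (v x) else 0) * ξ x)
      (volume.restrict Ω) := by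
    have hum := (h.locInt hu).aestronglyMeasurable.aemeasurable
    have hvm := (h.locInt hv).aestronglyMeasurable.aemeasurable
    have hcut : AEMeasurable (fun x => (Set.Ioi (0:ℝ)).indicator (fun _ => (1:ℝ)) (u x - v x)) :=
      (measurable_const.indicator measurableSet_Ioi).comp_aemeasurable (hum.sub hvm)
    refine ((igu.sub igv).mul_bdd (c := 1) hcut.aestronglyMeasurable.restrict
      (Eventually.of_forall fun x => ?_)).congr (Eventually.of_forall fun x => ?_)
    · simp only [Set.indicator]; split_ifs <;> simp
    · simp only [Set.indicator, Set.mem_Ioi, Pi.sub_apply]; split_ifs <;> ring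
  have eMax : ∫ x, max (u x) (v x) * Lξ x = (∫ x, v x * Lξ x) + ∫ x, max (u x - v x) 0 * Lξ x := by
    rw [← integral_add iv ip]
    congr 1; funext x
    rw [← add_mul]; congr 1
    rcases le_total (u x) (v x) with hh | hh
    · rw [max_eq_right hh, max_eq_right (by linarith)]; ring
    · rw [max_eq_left hh, max_eq_left (by linarith)]; ring
  have eMin : ∫ x, min (u x) (v x) * Lξ x = (∫ x, u x * Lξ x) - ∫ x, max (u x - v x) 0 * Lξ x := by
    rw [← integral_sub iu ip]
    congr 1; funext x
    rw [← sub_mul]; congr 1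
    rcases le_total (u x) (v x) with hh | hh
    · rw [min_eq_left hh, max_eq_right (by linarith)]; ring
    · rw [min_eq_right hh, max_eq_left (by linarith)]; ring
  have gMax : ∫ x in Ω, g (max (u x) (v x)) * ξ x = (∫ x in Ω, g (v x) * ξ x) +
      ∫ x in Ω, (if 0 < u x - v x then g (u x) - g (v x) else 0) * ξ x := by
    rw [← integral_add igv igp]
    congr 1; funext x
    rw [← add_mul]; congr 1
    split_ifs with hh
    · rw [max_eq_left (by linarith)]; ring
    · rw [max_eq_right (by linarith)]; ring
  have gMin : ∫ x in Ω, g (min (u x) (v x)) * ξ x = (∫ x in Ω, g (u x) * ξ x) -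
      ∫ x in Ω, (if 0 < u x - v x then g (u x) - g (v x) else 0) * ξ x := by
    rw [← integral_sub igu igp]
    congr 1; funext x
    rw [← sub_mul]; congr 1
    split_ifs with hh
    · rw [min_eq_right (by linarith)]; ring
    · rw [min_eq_left (by linarith)]; ring
  constructor <;> linarith
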